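/- Let d ≥ 3. There exist constants c, c' > 0, depending only on d, such that for every function u : ℤ^d → ℂ one has, in [0,∞], c · Q_0[u] ≤ Σ_{x∈ℤ^d} ∫_{x+(0,1)^d} |∇(𝓘u)(ξ)|² dξ ≤ c' · Q_0[u], where on each open unit cell x + (0,1)^d the interpolant 𝓘u is a (poly-linear) polynomial and ∇ denotes its gradient there. -/

import Mathlib

open scoped ENNReal NNReal Topology
open Filter MeasureTheory

noncomputable section

/-- The lattice point `1_j` in `ℤ^d`: `j`-th coordinate `1`, all others `0`. -/
def latUnit (d : ℕ) (j : Fin d) : Fin d → ℤ := fun i => if i = j then 1 else 0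

/-- The discrete Dirichlet form `Q_0[u] = Σ_x Σ_j |u(x+1_j) − u(x)|²`, valued in `[0,∞]`. -/
def Q0 {d : ℕ} (u : (Fin d → ℤ) → ℂ) : ℝ≥0∞ :=
  ∑' x : Fin d → ℤ, ∑ j : Fin d, ((‖u (x + latUnit d j) - u x‖₊ : ℝ≥0∞)) ^ 2

/-- `b_V[u] = Σ_x V(x)|u(x)|²`, valued in `[0,∞]`. -/
def bV {d : ℕ} (V : (Fin d → ℤ) → ℝ) (u : (Fin d → ℤ) → ℂ) : ℝ≥0∞ :=
  ∑' x : Fin d → ℤ, ENNReal.ofReal (V x) * ((‖u x‖₊ : ℝ≥0∞)) ^ 2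

/-- The Euclidean norm `|x|` of a lattice point. -/
def znorm {d : ℕ} (x : Fin d → ℤ) : ℝ := Real.sqrt (∑ i, ((x i : ℝ)) ^ 2)

/-- The poly-linear interpolation polynomial on the cell with lower-left vertex `x`,
evaluated at local coordinates `t ∈ [0,1]^d`. -/
def interpCell {d : ℕ} (u : (Fin d → ℤ) → ℂ) (x : Fin d → ℤ) (t : Fin d → ℝ) : ℂ :=
  ∑ ε : Fin d → Fin 2, u (x + fun i => ((ε i : ℕ) : ℤ)) *
    ((∏ j, ((1 - ((ε j : ℕ) : ℝ)) * (1 - t j) + ((ε j : ℕ) : ℝ) * t j) : ℝ) : ℂ)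

/-- The poly-linear interpolation `𝓘u : ℝ^d → ℂ` of `u : ℤ^d → ℂ`. -/
def interp {d : ℕ} (u : (Fin d → ℤ) → ℂ) (ξ : Fin d → ℝ) : ℂ :=
  interpCell u (fun i => ⌊ξ i⌋) (fun i => ξ i - ⌊ξ i⌋)

/-- The `k`-th component of the gradient of the poly-linear interpolation polynomial
on the cell with lower-left vertex `x`, at local coordinates `t`. -/
def interpCellGrad {d : ℕ} (u : (Fin d → ℤ) → ℂ) (x : Fin d → ℤ) (t : Fin d → ℝ)
    (k : Fin d) : ℂ :=
  ∑ ε : Fin d → Fin 2, u (x + fun i => ((ε i : ℕ) : ℤ)) *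
    (((2 * ((ε k : ℕ) : ℝ) - 1) *
      ∏ j ∈ Finset.univ.erase k,
        ((1 - ((ε j : ℕ) : ℝ)) * (1 - t j) + ((ε j : ℕ) : ℝ) * t j) : ℝ) : ℂ)

/-- `∫_{x+(0,1)^d} |∇(𝓘u)(ξ)|² dξ`: the Dirichlet integral of the poly-linear
interpolant over the open unit cell with lower-left vertex `x`. -/
def cellEnergy {d : ℕ} (u : (Fin d → ℤ) → ℂ) (x : Fin d → ℤ) : ℝ≥0∞ :=
  ∫⁻ t in Set.univ.pi (fun _ : Fin d => Set.Ioo (0 : ℝ) 1),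
    ∑ k : Fin d, ((‖interpCellGrad u x t k‖₊ : ℝ≥0∞)) ^ 2

/-- The forward difference `u(x + 1_k) − u(x)`. -/
def latDiff {d : ℕ} (u : (Fin d → ℤ) → ℂ) (k : Fin d) (x : Fin d → ℤ) : ℂ :=
  u (x + latUnit d k) - u x

/-- The open unit cube `(0,1)^d`, as a measure: Lebesgue measure restricted to it. -/
def cubeMeasure (d : ℕ) : Measure (Fin d → ℝ) :=
  Measure.pi fun _ => (volume : Measure ℝ).restrict (Set.Ioo (0 : ℝ) 1)

lemma volume_restrict_cube (d : ℕ) :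
    (volume : Measure (Fin d → ℝ)).restrict (Set.univ.pi fun _ => Set.Ioo (0 : ℝ) 1) =
      cubeMeasure d := by
  rw [volume_pi, Measure.restrict_pi_pi]
  rfl

instance : IsProbabilityMeasure ((volume : Measure ℝ).restrict (Set.Ioo (0 : ℝ) 1)) :=
  ⟨by simp⟩

instance (d : ℕ) : IsProbabilityMeasure (cubeMeasure d) := by
  unfold cubeMeasure
  infer_instance

lemma ae_mem_cube (d : ℕ) : ∀ᵐ t ∂cubeMeasure d, ∀ j, t j ∈ Set.Ioo (0 : ℝ) 1 := by
  rw [← volume_restrict_cube]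
  filter_upwards [ae_restrict_mem (MeasurableSet.univ_pi fun _ => measurableSet_Ioo)] with t ht j
  exact ht j trivial

lemma continuous_interpCellGrad {d : ℕ} (u : (Fin d → ℤ) → ℂ) (x : Fin d → ℤ) (k : Fin d) :
    Continuous fun t => interpCellGrad u x t k := by
  unfold interpCellGrad
  fun_prop

lemma cellEnergy_eq_sum {d : ℕ} (u : (Fin d → ℤ) → ℂ) (x : Fin d → ℤ) :
    cellEnergy u x = ∑ k, ∫⁻ t, ‖interpCellGrad u x t k‖ₑ ^ 2 ∂cubeMeasure d := by
  rw [cellEnergy, volume_restrict_cube, ← lintegral_finsetSum]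
  · rfl
  · exact fun k _ => (continuous_interpCellGrad u x k).measurable.enorm.pow_const 2

/-- A sum over the vertices of the cube, grouped into edges in direction `k`. -/
lemma sum_vertices_eq_sum_edges {d : ℕ} (k : Fin d) (F : (Fin d → Fin 2) → ℂ) :
    ∑ ε, F ε = ∑ ε, if ε k = 0 then F ε + F (Function.update ε k 1) else 0 := by
  rw [← Finset.sum_filter, Finset.sum_add_distrib,
    ← Finset.sum_filter_add_sum_filter_not Finset.univ (fun ε : Fin d → Fin 2 => ε k = 0)]
  congr 1
  refine Finset.sum_bij' (fun ε _ => Function.update ε k 0) (fun ε _ => Function.update ε k 1)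
    ?_ ?_ ?_ ?_ ?_
  · simp
  · simp
  · intro ε hε
    have h : ε k = 1 := by
      have := (Finset.mem_filter.1 hε).2
      omega
    simp [← h]
  · intro ε hε
    have h : ε k = 0 := (Finset.mem_filter.1 hε).2
    simp [← h]
  · intro ε hε
    have h : ε k = 1 := by
      have := (Finset.mem_filter.1 hε).2
      omega
    simp [← h]

lemma interpCellGrad_eq {d : ℕ} (u : (Fin d → ℤ) → ℂ) (x : Fin d → ℤ) (t : Fin d → ℝ)
    (k : Fin d) :
    interpCellGrad u x t k = ∑ ε : Fin d → Fin 2, if ε k = 0 then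
      latDiff u k (x + fun i => ((ε i : ℕ) : ℤ)) *
        ((∏ j ∈ Finset.univ.erase k,
          ((1 - ((ε j : ℕ) : ℝ)) * (1 - t j) + ((ε j : ℕ) : ℝ) * t j) : ℝ) : ℂ) else 0 := by
  rw [interpCellGrad, sum_vertices_eq_sum_edges k]
  refine Finset.sum_congr rfl fun ε _ => ?_
  split_ifs with h
  · have hx : (x + fun i => ((Function.update ε k 1 i : ℕ) : ℤ)) =
        (x + fun i => ((ε i : ℕ) : ℤ)) + latUnit d k := by
      ext i
      by_cases hi : i = k
      · subst hi
        simp [latUnit, h]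
      · simp [latUnit, hi]
    have hp : ∏ j ∈ Finset.univ.erase k,
          ((1 - ((Function.update ε k 1 j : ℕ) : ℝ)) * (1 - t j) +
            ((Function.update ε k 1 j : ℕ) : ℝ) * t j) =
        ∏ j ∈ Finset.univ.erase k,
          ((1 - ((ε j : ℕ) : ℝ)) * (1 - t j) + ((ε j : ℕ) : ℝ) * t j) := by
      refine Finset.prod_congr rfl fun j hj => ?_
      rw [Function.update_of_ne (Finset.ne_of_mem_erase hj)]
    rw [hx, hp, latDiff, h]
    simp only [Function.update_self, Complex.ofReal_mul]
    norm_num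
    ring
  · rfl

lemma enorm_interpCellGrad_le {d : ℕ} (u : (Fin d → ℤ) → ℂ) (x : Fin d → ℤ)
    {t : Fin d → ℝ} (ht : ∀ j, t j ∈ Set.Ioo (0 : ℝ) 1) (k : Fin d) :
    ‖interpCellGrad u x t k‖ₑ ≤
      ∑ ε : Fin d → Fin 2, ‖latDiff u k (x + fun i => ((ε i : ℕ) : ℤ))‖ₑ := by
  rw [interpCellGrad_eq]
  refine (enorm_sum_le _ _).trans (Finset.sum_le_sum fun ε _ => ?_)
  split_ifs
  · rw [enorm_mul]
    refine mul_le_of_le_one_right' ?_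
    rw [← ofReal_norm, ENNReal.ofReal_le_one, Complex.norm_real, Real.norm_eq_abs,
      Finset.abs_prod]
    refine Finset.prod_le_one (fun _ _ => abs_nonneg _) fun j _ => ?_
    obtain ⟨h0, h1⟩ := ht j
    rw [abs_le]
    obtain h | h : ε j = 0 ∨ ε j = 1 := by omega
    all_goals
      rw [h]
      constructor <;> norm_num <;> linarith
  · simp

lemma cellEnergy_le {d : ℕ} (u : (Fin d → ℤ) → ℂ) (x : Fin d → ℤ) :
    cellEnergy u x ≤ 2 ^ d * ∑ ε : Fin d → Fin 2,
      ∑ k, ‖latDiff u k (x + fun i => ((ε i : ℕ) : ℤ))‖ₑ ^ 2 := by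
  rw [cellEnergy_eq_sum, Finset.sum_comm, Finset.mul_sum]
  refine Finset.sum_le_sum fun k _ => ?_
  calc ∫⁻ t, ‖interpCellGrad u x t k‖ₑ ^ 2 ∂cubeMeasure d
      ≤ ∫⁻ _, (∑ ε : Fin d → Fin 2, ‖latDiff u k (x + fun i => ((ε i : ℕ) : ℤ))‖ₑ) ^ 2
          ∂cubeMeasure d := by
        refine lintegral_mono_ae ?_
        filter_upwards [ae_mem_cube d] with t ht
        gcongr
        exact enorm_interpCellGrad_le u x ht k
    _ = (∑ ε : Fin d → Fin 2, ‖latDiff u k (x + fun i => ((ε i : ℕ) : ℤ))‖ₑ) ^ 2 := by simp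
    _ ≤ _ := by
        have := ENNReal.rpow_sum_le_const_mul_sum_rpow (Finset.univ : Finset (Fin d → Fin 2))
          (fun ε => ‖latDiff u k (x + fun i => ((ε i : ℕ) : ℤ))‖ₑ) (p := 2) (by norm_num)
        norm_num at this
        exact this

lemma Q0_eq {d : ℕ} (u : (Fin d → ℤ) → ℂ) : Q0 u = ∑' x, ∑ k, ‖latDiff u k x‖ₑ ^ 2 := rfl

lemma tsum_cellEnergy_le {d : ℕ} (u : (Fin d → ℤ) → ℂ) :
    ∑' x, cellEnergy u x ≤ 4 ^ d * Q0 u := by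
  calc ∑' x, cellEnergy u x
      ≤ ∑' x, 2 ^ d * ∑ ε : Fin d → Fin 2,
          ∑ k, ‖latDiff u k (x + fun i => ((ε i : ℕ) : ℤ))‖ₑ ^ 2 :=
        ENNReal.tsum_le_tsum (cellEnergy_le u)
    _ = 2 ^ d * ∑ ε : Fin d → Fin 2, ∑' x,
          ∑ k, ‖latDiff u k (x + fun i => ((ε i : ℕ) : ℤ))‖ₑ ^ 2 := by
        rw [ENNReal.tsum_mul_left, Summable.tsum_finsetSum fun _ _ => ENNReal.summable]
    _ = 2 ^ d * ∑ ε : Fin d → Fin 2, Q0 u := by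
        congr 1
        refine Finset.sum_congr rfl fun ε _ => ?_
        exact (Equiv.addRight fun i => ((ε i : ℕ) : ℤ)).tsum_eq
          (fun x => ∑ k, ‖latDiff u k x‖ₑ ^ 2)
    _ = 4 ^ d * Q0 u := by
        rw [Finset.sum_const, nsmul_eq_mul, ← mul_assoc]
        congr 1
        simp only [Finset.card_univ, Fintype.card_pi, Fintype.card_fin, Finset.prod_const]
        rw [Nat.cast_pow, ← mul_pow]
        norm_num

/-- The weight `4 − 6s` is biorthogonal to the hat functions: it integrates `1 − s` to `1` and
`s` to `0` over the unit interval. -/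
lemma integral_hat_mul_weight (e : Fin 2) :
    ∫ s in Set.Ioo (0 : ℝ) 1, ((1 - ((e : ℕ) : ℝ)) * (1 - s) + ((e : ℕ) : ℝ) * s) * (4 - 6 * s) =
      if e = 0 then 1 else 0 := by
  rw [← integral_Ioc_eq_integral_Ioo, ← intervalIntegral.integral_of_le zero_le_one]
  fin_cases e
  · have : ∀ s : ℝ, HasDerivAt (fun s : ℝ => 4 * s - 5 * s ^ 2 + 2 * s ^ 3)
        (((1 - (((0 : Fin 2) : ℕ) : ℝ)) * (1 - s) + (((0 : Fin 2) : ℕ) : ℝ) * s) *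
          (4 - 6 * s)) s := fun s => by
      refine HasDerivAt.congr_deriv
        ((((hasDerivAt_id s).const_mul 4).sub ((hasDerivAt_pow 2 s).const_mul 5)).add
        ((hasDerivAt_pow 3 s).const_mul 2)) ?_
      norm_num
      ring
    refine (intervalIntegral.integral_eq_sub_of_hasDerivAt (fun s _ => this s)
      (Continuous.intervalIntegrable (by fun_prop) _ _)).trans ?_
    norm_num
  · have : ∀ s : ℝ, HasDerivAt (fun s : ℝ => 2 * s ^ 2 - 2 * s ^ 3)
        (((1 - (((1 : Fin 2) : ℕ) : ℝ)) * (1 - s) + (((1 : Fin 2) : ℕ) : ℝ) * s) *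
          (4 - 6 * s)) s := fun s => by
      refine HasDerivAt.congr_deriv
        (((hasDerivAt_pow 2 s).const_mul 2).sub ((hasDerivAt_pow 3 s).const_mul 2)) ?_
      norm_num
      ring
    refine (intervalIntegral.integral_eq_sub_of_hasDerivAt (fun s _ => this s)
      (Continuous.intervalIntegrable (by fun_prop) _ _)).trans ?_
    norm_num

lemma integral_weight : ∫ s in Set.Ioo (0 : ℝ) 1, (4 - 6 * s) = 1 := by
  rw [← integral_Ioc_eq_integral_Ioo, ← intervalIntegral.integral_of_le zero_le_one]
  have : ∀ s : ℝ, HasDerivAt (fun s : ℝ => 4 * s - 3 * s ^ 2) (4 - 6 * s) s := fun s => by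
    refine HasDerivAt.congr_deriv
      (((hasDerivAt_id s).const_mul 4).sub ((hasDerivAt_pow 2 s).const_mul 3)) ?_
    norm_num
    ring
  refine (intervalIntegral.integral_eq_sub_of_hasDerivAt (fun s _ => this s)
    (Continuous.intervalIntegrable (by fun_prop) _ _)).trans ?_
  norm_num

lemma Continuous.integrable_restrict_Ioo {f : ℝ → ℝ} (hf : Continuous f) :
    Integrable f ((volume : Measure ℝ).restrict (Set.Ioo (0 : ℝ) 1)) :=
  (hf.integrableOn_Icc (a := 0) (b := 1)).mono_set Set.Ioo_subset_Icc_self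

/-- The forward difference at `x` is recovered from the gradient of the interpolant on the cell
at `x` by integrating against a product of weights. -/
lemma integral_interpCellGrad_mul_weight {d : ℕ} (u : (Fin d → ℤ) → ℂ) (x : Fin d → ℤ)
    (k : Fin d) :
    ∫ t, interpCellGrad u x t k * ((∏ j, (4 - 6 * t j) : ℝ) : ℂ) ∂cubeMeasure d =
      latDiff u k x := by
  set h : (Fin d → Fin 2) → Fin d → ℝ → ℝ := fun ε j s =>
    (if j = k then 1 else (1 - ((ε j : ℕ) : ℝ)) * (1 - s) + ((ε j : ℕ) : ℝ) * s) * (4 - 6 * s)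
    with hh
  have hcont : ∀ ε j, Continuous (h ε j) := fun ε j => by
    by_cases hj : j = k <;> simp only [hh, hj, if_true, if_false] <;> fun_prop
  have hint : ∀ ε j, ∫ s in Set.Ioo (0 : ℝ) 1, h ε j s =
      if j = k then 1 else if ε j = 0 then 1 else 0 := fun ε j => by
    by_cases hj : j = k
    · simp only [hh, hj, if_true, one_mul, integral_weight]
    · simp only [hh, hj, if_false, integral_hat_mul_weight]
  have hprod : ∀ ε, ∫ t, ((∏ j, h ε j (t j) : ℝ) : ℂ) ∂cubeMeasure d =
      ((∏ j, if j = k then 1 else if ε j = 0 then 1 else 0 : ℝ) : ℂ) := fun ε => by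
    rw [integral_complex_ofReal, cubeMeasure, integral_fintype_prod_eq_prod]
    simp only [hint]
  have hintegrable : ∀ ε, Integrable (fun t => ((∏ j, h ε j (t j) : ℝ) : ℂ)) (cubeMeasure d) :=
    fun ε => (Integrable.fintype_prod_dep fun j => (hcont ε j).integrable_restrict_Ioo).ofReal
  have hrw : ∀ t, interpCellGrad u x t k * ((∏ j, (4 - 6 * t j) : ℝ) : ℂ) =
      ∑ ε : Fin d → Fin 2, (if ε k = 0 then latDiff u k (x + fun i => ((ε i : ℕ) : ℤ)) else 0) *
        ((∏ j, h ε j (t j) : ℝ) : ℂ) := fun t => by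
    rw [interpCellGrad_eq, Finset.sum_mul]
    refine Finset.sum_congr rfl fun ε _ => ?_
    split_ifs
    · rw [mul_assoc, ← Complex.ofReal_mul]
      congr 2
      simp only [hh]
      rw [Finset.prod_mul_distrib]
      congr 1
      rw [← Finset.mul_prod_erase Finset.univ (fun j => if j = k then _ else _)
        (Finset.mem_univ k), if_pos rfl, one_mul]
      exact Finset.prod_congr rfl fun j hj => by rw [if_neg (Finset.ne_of_mem_erase hj)]
    · simp
  simp only [hrw]
  rw [integral_finsetSum _ fun ε _ => (hintegrable ε).const_mul _]
  simp only [integral_const_mul, hprod]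
  rw [Finset.sum_eq_single 0]
  · simp
    congr 1
    ext i
    simp
  · intro ε _ hε
    by_cases hk : ε k = 0
    · obtain ⟨j, hj⟩ := Function.ne_iff.1 hε
      have hjk : j ≠ k := by
        rintro rfl
        exact hj hk
      rw [Finset.prod_eq_zero (Finset.mem_univ j)]
      · simp
      · exact (if_neg hjk).trans (if_neg hj)
    · simp [hk]
  · simp

lemma lintegral_sq_le {α : Type*} [MeasurableSpace α] (μ : Measure α) [IsProbabilityMeasure μ]
    {f : α → ℝ≥0∞} (hf : AEMeasurable f μ) : (∫⁻ a, f a ∂μ) ^ 2 ≤ ∫⁻ a, f a ^ 2 ∂μ := by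
  have := ENNReal.lintegral_mul_le_Lp_mul_Lq μ Real.HolderConjugate.two_two hf
    (aemeasurable_const (b := 1))
  simp only [Pi.mul_apply, mul_one, one_pow, ENNReal.one_rpow, lintegral_const,
    measure_univ, ENNReal.rpow_ofNat] at this
  calc (∫⁻ a, f a ∂μ) ^ 2 ≤ ((∫⁻ a, f a ^ 2 ∂μ) ^ (1 / 2 : ℝ)) ^ 2 := by gcongr
    _ = _ := by
      rw [← ENNReal.rpow_natCast, ← ENNReal.rpow_mul]
      norm_num

lemma enorm_latDiff_sq_le {d : ℕ} (u : (Fin d → ℤ) → ℂ) (x : Fin d → ℤ) (k : Fin d) :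
    ‖latDiff u k x‖ₑ ^ 2 ≤ 16 ^ d * ∫⁻ t, ‖interpCellGrad u x t k‖ₑ ^ 2 ∂cubeMeasure d := by
  have hmeas : AEMeasurable (fun t => ‖interpCellGrad u x t k‖ₑ) (cubeMeasure d) :=
    (continuous_interpCellGrad u x k).measurable.enorm.aemeasurable
  have hle : ‖latDiff u k x‖ₑ ≤ 4 ^ d * ∫⁻ t, ‖interpCellGrad u x t k‖ₑ ∂cubeMeasure d := by
    rw [← integral_interpCellGrad_mul_weight u x k, ← lintegral_const_mul'' _ hmeas]
    refine (enorm_integral_le_lintegral_enorm _).trans (lintegral_mono_ae ?_)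
    filter_upwards [ae_mem_cube d] with t ht
    rw [enorm_mul, mul_comm]
    gcongr
    rw [← ofReal_norm, Complex.norm_real, Real.norm_eq_abs, Finset.abs_prod]
    refine ENNReal.ofReal_le_of_le_toReal ?_
    calc ∏ j, |4 - 6 * t j| ≤ ∏ _j : Fin d, (4 : ℝ) := by
          refine Finset.prod_le_prod (fun _ _ => abs_nonneg _) fun j _ => ?_
          obtain ⟨h0, h1⟩ := ht j
          rw [abs_le]
          constructor <;> linarith
      _ = _ := by simp
  calc ‖latDiff u k x‖ₑ ^ 2
      ≤ (4 ^ d * ∫⁻ t, ‖interpCellGrad u x t k‖ₑ ∂cubeMeasure d) ^ 2 := by gcongr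
    _ = 16 ^ d * (∫⁻ t, ‖interpCellGrad u x t k‖ₑ ∂cubeMeasure d) ^ 2 := by
        rw [mul_pow, ← pow_mul, mul_comm d, pow_mul]
        norm_num
    _ ≤ _ := by
        gcongr
        exact lintegral_sq_le _ hmeas

lemma Q0_le_tsum_cellEnergy {d : ℕ} (u : (Fin d → ℤ) → ℂ) :
    Q0 u ≤ 16 ^ d * ∑' x, cellEnergy u x := by
  rw [Q0_eq, ← ENNReal.tsum_mul_left]
  refine ENNReal.tsum_le_tsum fun x => ?_
  rw [cellEnergy_eq_sum, Finset.mul_sum]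
  exact Finset.sum_le_sum fun k _ => enorm_latDiff_sq_le u x k

/-- two-sided equivalence of the discrete Dirichlet form `Q_0[u]` and the
Dirichlet integral of the poly-linear interpolant `𝓘u`, summed over all unit cells. -/
theorem interpolation_energy_equivalence (d : ℕ) (hd : 3 ≤ d) :
    ∃ c c' : ℝ, 0 < c ∧ 0 < c' ∧
      ∀ u : (Fin d → ℤ) → ℂ,
        ENNReal.ofReal c * Q0 u ≤ (∑' x : Fin d → ℤ, cellEnergy u x) ∧
        (∑' x : Fin d → ℤ, cellEnergy u x) ≤ ENNReal.ofReal c' * Q0 u := by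
  refine ⟨(16 ^ d)⁻¹, 4 ^ d, by positivity, by positivity, fun u => ⟨?_, ?_⟩⟩
  · rw [ENNReal.ofReal_inv_of_pos (by positivity), ENNReal.ofReal_pow (by norm_num),
      ENNReal.ofReal_ofNat, mul_comm, ← div_eq_mul_inv]
    exact ENNReal.div_le_of_le_mul' (Q0_le_tsum_cellEnergy u)
  · rw [ENNReal.ofReal_pow (by norm_num), ENNReal.ofReal_ofNat]
    exact tsum_cellEnergy_le u
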